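/- arXiv:2512.20680 — 4 statements merged into one kernel-verified Lean document; each statement's English description precedes it below -/
import Mathlib

section
/- For every lattice polytope P in ℝ^d (the convex hull of finitely many points of ℤ^d) there exists a polynomial f with rational coefficients of degree equal to the dimension of P such that for every nonnegative integer m, the number of lattice points in the m-th dilation m·P equals f(m). -/
/-- The set of lattice points of `ℝ^d`, i.e. points with integer coordinates. -/
def latticePts (d : ℕ) : Set (Fin d → ℝ) :=
  Set.range (fun v : Fin d → ℤ => fun i => (v i : ℝ))

section LexTriangulation

open Finset

/-- A vector is lexicographically positive if its first nonzero entry is positive. -/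
def LexPos {n : ℕ} (r : Fin n → ℝ) : Prop := ∃ i, 0 < r i ∧ ∀ j < i, r j = 0

theorem LexPos.zero_nonneg {n : ℕ} {r : Fin (n + 1) → ℝ} (hr : LexPos r) : 0 ≤ r 0 := by
  obtain ⟨i, hi, hj⟩ := hr
  rcases (Fin.zero_le i).eq_or_lt with h | h
  · exact h ▸ hi.le
  · exact (hj 0 h).ge

theorem LexPos.smul {n : ℕ} {r : Fin n → ℝ} (hr : LexPos r) {c : ℝ} (hc : 0 < c) :
    LexPos (c • r) := by
  obtain ⟨i, hi, hj⟩ := hr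
  exact ⟨i, mul_pos hc hi, fun j h => by simp [hj j h]⟩

theorem lexPos_or_lexPos_neg {n : ℕ} {r : Fin n → ℝ} (hr : r ≠ 0) : LexPos r ∨ LexPos (-r) := by
  have hne : (univ.filter fun i => r i ≠ 0).Nonempty := by
    obtain ⟨i, hi⟩ := Function.ne_iff.1 hr
    exact ⟨i, by simpa using hi⟩
  obtain ⟨i, hi⟩ := exists_minimal hne
  have hi0 : r i ≠ 0 := by simpa using hi.1
  have hj : ∀ j < i, r j = 0 := fun j h => by
    by_contra hj
    exact absurd (hi.2 (by simpa using hj) h.le) (not_le.2 h)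
  rcases hi0.lt_or_gt with h | h
  · exact Or.inr ⟨i, by simpa using h, fun j h => by simp [hj j h]⟩
  · exact Or.inl ⟨i, h, hj⟩

theorem IsCompact.exists_lexMax {n : ℕ} {K : Set (Fin n → ℝ)} (hK : IsCompact K)
    (hne : K.Nonempty) : ∃ t ∈ K, ∀ t' ∈ K, ¬ LexPos (t' - t) := by
  induction n with
  | zero =>
    obtain ⟨t, ht⟩ := hne
    exact ⟨t, ht, fun t' _ ⟨i, _⟩ => i.elim0⟩
  | succ n ih =>
    obtain ⟨a, ha, hmax⟩ := hK.exists_isMaxOn hne (continuous_apply 0).continuousOn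
    have hcl : IsClosed {t : Fin (n + 1) → ℝ | t 0 = a 0} :=
      isClosed_eq (continuous_apply 0) continuous_const
    have hK' := (hK.inter_right hcl).image (f := fun t : Fin (n + 1) → ℝ => Fin.tail t)
      (continuous_pi fun i => continuous_apply i.succ)
    obtain ⟨_, ⟨t, ⟨ht, ht0⟩, rfl⟩, hs⟩ := ih hK' ⟨_, a, ⟨ha, rfl⟩, rfl⟩
    refine ⟨t, ht, fun t' ht' ⟨i, hi, hj⟩ => ?_⟩
    have h0 : t' 0 ≤ t 0 := (hmax ht').trans_eq (Eq.symm ht0)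
    cases i using Fin.cases with
    | zero =>
      rw [Pi.sub_apply] at hi
      linarith
    | succ i =>
      have h0' : t' 0 = a 0 := by
        have := hj 0 (Fin.succ_pos i)
        rw [Pi.sub_apply, sub_eq_zero] at this
        exact this.trans ht0
      exact hs _ ⟨t', ⟨ht', h0'⟩, rfl⟩
        ⟨i, hi, fun j h => hj j.succ (Fin.succ_lt_succ_iff.2 h)⟩

section

variable {E : Type*} [NormedAddCommGroup E] [NormedSpace ℝ E] {n : ℕ}

/-- `r` is an affine relation between the points `u i`. -/
def IsAffineRelation (u : Fin (n + 1) → E) (r : Fin (n + 1) → ℝ) : Prop :=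
  ∑ i, r i = 0 ∧ ∑ i, r i • u i = 0

theorem IsAffineRelation.smul {u : Fin (n + 1) → E} {r : Fin (n + 1) → ℝ}
    (hr : IsAffineRelation u r) (c : ℝ) : IsAffineRelation u (c • r) := by
  constructor
  · simp [← mul_sum, hr.1]
  · simp [mul_smul, ← smul_sum, hr.2]

theorem isAffineRelation_sub {u : Fin (n + 1) → E} {s t : Fin (n + 1) → ℝ}
    (h : ∑ i, s i = ∑ i, t i) (hu : ∑ i, s i • u i = ∑ i, t i • u i) :
    IsAffineRelation u (s - t) := by
  constructor
  · simp [h]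
  · simp [sub_smul, hu]

/-- A set of indices is a face (of the lexicographic triangulation with apex `u 0`) if no
lexicographically positive affine relation is nonnegative outside of it. The index `0` plays no
role in this condition. -/
def IsLexFace (u : Fin (n + 1) → E) (S : Finset (Fin (n + 1))) : Prop :=
  ∀ r, IsAffineRelation u r → LexPos r → ∃ i, i ≠ 0 ∧ i ∉ S ∧ r i < 0

/-- The indices different from `0` at which `t` is positive. -/
noncomputable def upperSupport (t : Fin (n + 1) → ℝ) : Finset (Fin (n + 1)) :=
  univ.filter fun i => i ≠ 0 ∧ 0 < t i

@[simp]
theorem mem_upperSupport {t : Fin (n + 1) → ℝ} {i : Fin (n + 1)} :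
    i ∈ upperSupport t ↔ i ≠ 0 ∧ 0 < t i := by
  simp [upperSupport]

/-- Coefficient vectors that are nonnegative and supported on a lexicographic face
together with `0`. -/
def IsLexRep (u : Fin (n + 1) → E) (t : Fin (n + 1) → ℝ) : Prop :=
  0 ≤ t ∧ IsLexFace u (upperSupport t)

theorem IsLexRep.not_lexPos {u : Fin (n + 1) → E} {s t : Fin (n + 1) → ℝ}
    (ht : IsLexRep u t) (hs : 0 ≤ s) (hr : IsAffineRelation u (s - t)) : ¬ LexPos (s - t) := by
  intro hl
  obtain ⟨i, hi0, hi, hlt⟩ := ht.2 _ hr hl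
  have hti : t i = 0 := by
    have : ¬ 0 < t i := fun h => hi (mem_upperSupport.2 ⟨hi0, h⟩)
    exact le_antisymm (not_lt.1 this) (ht.1 i)
  have := hs i
  simp [hti] at hlt this
  linarith

theorem IsLexRep.eq {u : Fin (n + 1) → E} {s t : Fin (n + 1) → ℝ}
    (hs : IsLexRep u s) (ht : IsLexRep u t) (h : ∑ i, s i = ∑ i, t i)
    (hu : ∑ i, s i • u i = ∑ i, t i • u i) : s = t := by
  by_contra hne
  rcases lexPos_or_lexPos_neg (sub_ne_zero.2 hne) with hl | hl
  · exact ht.not_lexPos hs.1 (isAffineRelation_sub h hu) hl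
  · rw [neg_sub] at hl
    exact hs.not_lexPos ht.1 (isAffineRelation_sub h.symm hu.symm) hl

theorem isLexRep_of_forall_not_lexPos {u : Fin (n + 1) → E} {t : Fin (n + 1) → ℝ} (ht : 0 ≤ t)
    (hmax : ∀ s, 0 ≤ s → IsAffineRelation u (s - t) → ¬ LexPos (s - t)) : IsLexRep u t := by
  refine ⟨ht, fun r hr hl => ?_⟩
  by_contra! hnn
  have hev : ∀ᶠ ε : ℝ in nhdsWithin 0 (Set.Ioi 0), ∀ i, 0 ≤ t i + ε * r i := by
    rw [Filter.eventually_all]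
    intro i
    by_cases hri : 0 ≤ r i
    · filter_upwards [self_mem_nhdsWithin] with ε hε
      have h1 := ht i
      have := mul_nonneg (le_of_lt hε) hri
      simp at h1
      linarith
    · have hi0 : i ≠ 0 := fun h => hri (h ▸ hl.zero_nonneg)
      have hti : 0 < t i := by
        by_contra h
        exact hri (hnn i hi0 fun hm => h (mem_upperSupport.1 hm).2)
      have hc : Filter.Tendsto (fun ε : ℝ => t i + ε * r i) (nhds 0) (nhds (t i + 0 * r i)) :=
        Continuous.tendsto (by fun_prop) 0
      rw [zero_mul, add_zero] at hc
      filter_upwards [nhdsWithin_le_nhds (hc.eventually_const_lt hti)] with ε hε using hε.le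
  obtain ⟨ε, hε, hpos⟩ := (hev.and self_mem_nhdsWithin).exists
  refine hmax (t + ε • r) (fun i => by simpa using hε i) ?_ ?_
  · simpa using hr.smul ε
  · simpa using hl.smul hpos

theorem exists_isLexRep (u : Fin (n + 1) → E) {t : Fin (n + 1) → ℝ} (ht : 0 ≤ t) :
    ∃ s, IsLexRep u s ∧ ∑ i, s i = ∑ i, t i ∧ ∑ i, s i • u i = ∑ i, t i • u i := by
  set K : Set (Fin (n + 1) → ℝ) :=
    {s | 0 ≤ s ∧ ∑ i, s i = ∑ i, t i ∧ ∑ i, s i • u i = ∑ i, t i • u i}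
  have hcl : IsClosed K :=
    isClosed_Ici.inter ((isClosed_eq (by fun_prop) continuous_const).inter
      (isClosed_eq (by fun_prop) continuous_const))
  have hK : IsCompact K := by
    refine (isCompact_Icc (a := 0) (b := fun _ => ∑ i, t i)).of_isClosed_subset hcl ?_
    exact fun s hs => ⟨hs.1, fun i =>
      hs.2.1 ▸ single_le_sum (f := s) (fun j _ => hs.1 j) (mem_univ i)⟩
  obtain ⟨s, hs, hmax⟩ := hK.exists_lexMax ⟨t, ht, rfl, rfl⟩
  refine ⟨s, isLexRep_of_forall_not_lexPos hs.1 fun s' hs' hr => hmax s' ⟨hs', ?_, ?_⟩, hs.2⟩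
  · rw [← hs.2.1]
    exact sub_eq_zero.1 (by simpa using hr.1)
  · rw [← hs.2.2]
    exact sub_eq_zero.1 (by simpa [sub_smul] using hr.2)

theorem IsLexFace.affineIndependent {u : Fin (n + 1) → E} {S : Finset (Fin (n + 1))}
    (hS : IsLexFace u S) : AffineIndependent ℝ fun i : ↥(insert 0 S) => u i := by
  rw [affineIndependent_iff_of_fintype]
  intro w hw hw'
  rw [univ.weightedVSub_eq_linear_combination hw] at hw'
  set r : Fin (n + 1) → ℝ := fun i => if h : i ∈ insert 0 S then w ⟨i, h⟩ else 0
  have hr' : ∀ i : ↥(insert 0 S), r i = w i := fun i => dif_pos i.2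
  have hoff : ∀ i, i ≠ 0 → i ∉ S → r i = 0 := fun i h0 hi => by simp [r, h0, hi]
  have hr : IsAffineRelation u r := by
    constructor
    · rw [← hw, ← sum_subset (subset_univ (insert 0 S)) fun i _ hi => dif_neg hi,
        ← sum_coe_sort]
      exact sum_congr rfl fun i _ => hr' i
    · rw [← hw', ← sum_subset (subset_univ (insert 0 S)) fun i _ hi => by
        rw [show r i = 0 from dif_neg hi, zero_smul], ← sum_coe_sort]
      exact sum_congr rfl fun i _ => by rw [hr']
  have hr0 : r = 0 := by
    by_contra hne
    rcases lexPos_or_lexPos_neg hne with hl | hl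
    · obtain ⟨i, h0, hi, hlt⟩ := hS r hr hl
      exact hlt.ne (hoff i h0 hi)
    · obtain ⟨i, h0, hi, hlt⟩ := hS (-r) (by simpa using hr.smul (-1)) hl
      exact hlt.ne (by simp [hoff i h0 hi])
  intro i
  rw [← hr' i, hr0, Pi.zero_apply]

theorem IsLexFace.card_le [FiniteDimensional ℝ E] {u : Fin (n + 1) → E} {S : Finset (Fin (n + 1))}
    (hS : IsLexFace u S) (h0 : 0 ∉ S) : #S ≤ Module.finrank ℝ (vectorSpan ℝ (Set.range u)) := by
  have hcard : Fintype.card ↥(insert 0 S) = #S + 1 := by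
    rw [Fintype.card_coe, card_insert_of_notMem h0]
  refine (hS.affineIndependent.finrank_vectorSpan hcard).ge.trans ?_
  exact Submodule.finrank_mono (vectorSpan_mono ℝ (by rintro _ ⟨i, rfl⟩; exact ⟨i, rfl⟩))

/-- The integer part of a coefficient vector, rounded so that the remainder lies in `[0, 1)` at the
index `0` and, at the other indices, in `(0, 1]` unless the entry vanishes. -/
noncomputable def integerPart (t : Fin (n + 1) → ℝ) (i : Fin (n + 1)) : ℕ :=
  if i = 0 then ⌊t i⌋₊ else ⌈t i⌉₊ - 1

/-- The remainder of a coefficient vector modulo its integer part. -/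
noncomputable def boxPart (t : Fin (n + 1) → ℝ) (i : Fin (n + 1)) : ℝ := t i - integerPart t i

theorem boxPart_bounds {t : Fin (n + 1) → ℝ} {i : Fin (n + 1)} (hi : i ≠ 0) (ht : 0 < t i) :
    0 < boxPart t i ∧ boxPart t i ≤ 1 := by
  have h1 : 1 ≤ ⌈t i⌉₊ := Nat.ceil_pos.2 ht
  have h2 := Nat.le_ceil (t i)
  have h3 := Nat.ceil_lt_add_one ht.le
  simp only [boxPart, integerPart, if_neg hi, Nat.cast_sub h1, Nat.cast_one]
  constructor <;> linarith

theorem integerPart_eq_zero {t : Fin (n + 1) → ℝ} {i : Fin (n + 1)} (hi : i ≠ 0) (ht : t i ≤ 0) :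
    integerPart t i = 0 := by
  simp [integerPart, hi, Nat.ceil_eq_zero.2 ht]

theorem boxPart_eq {t : Fin (n + 1) → ℝ} {i : Fin (n + 1)} (hi : i ≠ 0) (ht : t i ≤ 0) :
    boxPart t i = t i := by
  simp [boxPart, integerPart_eq_zero hi ht]

theorem upperSupport_boxPart (t : Fin (n + 1) → ℝ) :
    upperSupport (boxPart t) = upperSupport t := by
  ext i
  simp only [mem_upperSupport, and_congr_right_iff]
  intro hi
  rcases lt_or_ge 0 (t i) with h | h
  · simp [h, (boxPart_bounds hi h).1]
  · rw [boxPart_eq hi h]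

theorem boxPart_zero_lt_one (t : Fin (n + 1) → ℝ) : boxPart t 0 < 1 := by
  have := Nat.lt_floor_add_one (t 0)
  simp only [boxPart, integerPart, if_true]
  linarith

theorem boxPart_le_one {t : Fin (n + 1) → ℝ} {i : Fin (n + 1)} (hi : i ≠ 0) : boxPart t i ≤ 1 := by
  rcases lt_or_ge 0 (t i) with h | h
  · exact (boxPart_bounds hi h).2
  · rw [boxPart_eq hi h]
    linarith

theorem boxPart_nonneg {t : Fin (n + 1) → ℝ} (ht : 0 ≤ t) : 0 ≤ boxPart t := by
  intro i
  by_cases hi : i = 0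
  · subst hi
    simpa [boxPart, integerPart] using Nat.floor_le (ht 0)
  rcases lt_or_ge 0 (t i) with h | h
  · exact (boxPart_bounds hi h).1.le
  · rw [boxPart_eq hi h]
    exact ht i

theorem integerPart_mem {t : Fin (n + 1) → ℝ} {i : Fin (n + 1)} (hi : integerPart t i ≠ 0) :
    i ∈ insert 0 (upperSupport t) := by
  by_contra h
  simp only [mem_insert, mem_upperSupport, not_or, not_and, not_lt] at h
  exact hi (integerPart_eq_zero h.1 (h.2 h.1))

section Translate

variable {f : Fin (n + 1) → ℝ} {c : Fin (n + 1) → ℕ}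

theorem upperSupport_add (hc : ∀ i, c i ≠ 0 → i ∈ insert 0 (upperSupport f)) :
    upperSupport (fun i => f i + c i) = upperSupport f := by
  ext i
  simp only [mem_upperSupport, and_congr_right_iff]
  intro hi
  constructor
  · intro h
    by_cases hci : c i = 0
    · simpa [hci] using h
    · simpa [hi] using hc i hci
  · intro h
    positivity

theorem integerPart_add (hf : 0 ≤ f) (h0 : f 0 < 1) (h1 : ∀ i ≠ 0, f i ≤ 1)
    (hc : ∀ i, c i ≠ 0 → i ∈ insert 0 (upperSupport f)) :
    integerPart (fun i => f i + c i) = c := by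
  ext i
  by_cases hi : i = 0
  · subst hi
    rw [integerPart, if_pos rfl, Nat.floor_add_natCast (hf 0), Nat.floor_eq_zero.2 h0, zero_add]
  · rw [integerPart, if_neg hi, Nat.ceil_add_natCast (hf i)]
    by_cases hfi : 0 < f i
    · have : ⌈f i⌉₊ = 1 := by
        rw [Nat.ceil_eq_iff one_ne_zero]
        simpa [hfi] using h1 i hi
      omega
    · have hci : c i = 0 := by
        by_contra h
        have := hc i h
        simp [hi, hfi] at this
      simp [hci, Nat.ceil_eq_zero.2 (not_lt.1 hfi)]

theorem boxPart_add (hf : 0 ≤ f) (h0 : f 0 < 1) (h1 : ∀ i ≠ 0, f i ≤ 1)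
    (hc : ∀ i, c i ≠ 0 → i ∈ insert 0 (upperSupport f)) :
    boxPart (fun i => f i + c i) = f := by
  ext i
  simp [boxPart, integerPart_add hf h0 h1 hc]

end Translate

/-- The points of `Λ` in the `m`-th dilation of the convex hull of the `u i`. -/
def dilatePoints (u : Fin (n + 1) → E) (Λ : AddSubgroup E) (m : ℕ) : Set E :=
  {x | x ∈ Λ ∧ ∃ t : Fin (n + 1) → ℝ, 0 ≤ t ∧ ∑ i, t i = m ∧ ∑ i, t i • u i = x}

/-- The coefficient vectors of the points of `dilatePoints u Λ m` with respect to the lexicographic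
triangulation. -/
def lexReps (u : Fin (n + 1) → E) (Λ : AddSubgroup E) (m : ℕ) : Set (Fin (n + 1) → ℝ) :=
  {t | IsLexRep u t ∧ ∑ i, t i = m ∧ ∑ i, t i • u i ∈ Λ}

theorem image_lexReps (u : Fin (n + 1) → E) (Λ : AddSubgroup E) (m : ℕ) :
    (fun t : Fin (n + 1) → ℝ => ∑ i, t i • u i) '' lexReps u Λ m = dilatePoints u Λ m := by
  ext x
  constructor
  · rintro ⟨t, ⟨ht, hm, hx⟩, rfl⟩
    exact ⟨hx, t, ht.1, hm, rfl⟩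
  · rintro ⟨hx, t, ht, hm, rfl⟩
    obtain ⟨s, hs, hst, hsu⟩ := exists_isLexRep u ht
    exact ⟨s, ⟨hs, hst.trans hm, hsu.symm ▸ hx⟩, hsu⟩

theorem injOn_lexReps (u : Fin (n + 1) → E) (Λ : AddSubgroup E) (m : ℕ) :
    Set.InjOn (fun t : Fin (n + 1) → ℝ => ∑ i, t i • u i) (lexReps u Λ m) :=
  fun _ hs _ ht h => hs.1.eq ht.1 (hs.2.1.trans ht.2.1.symm) h

theorem ncard_lexReps (u : Fin (n + 1) → E) (Λ : AddSubgroup E) (m : ℕ) :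
    (lexReps u Λ m).ncard = (dilatePoints u Λ m).ncard := by
  rw [← image_lexReps, (injOn_lexReps u Λ m).ncard_image]

theorem finite_lexReps {u : Fin (n + 1) → E} {Λ : AddSubgroup E} {m : ℕ}
    (h : (dilatePoints u Λ m).Finite) : (lexReps u Λ m).Finite :=
  Set.Finite.of_finite_image (by rwa [image_lexReps]) (injOn_lexReps u Λ m)

/-- The lattice representations in the fundamental boxes of the half-open cones of the
lexicographic triangulation. -/
def boxReps (u : Fin (n + 1) → E) (Λ : AddSubgroup E) : Set (Fin (n + 1) → ℝ) :=
  {f | f 0 < 1 ∧ (∀ i ≠ 0, f i ≤ 1) ∧ ∃ h : ℕ, f ∈ lexReps u Λ h}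

theorem sum_lt_card_add_one {f : Fin (n + 1) → ℝ} (h0 : f 0 < 1)
    (h1 : ∀ i ≠ 0, f i ≤ 1) : ∑ i, f i < #(upperSupport f) + 1 := by
  have hle : ∑ i ∈ univ.erase 0, f i ≤ #(upperSupport f) := by
    rw [card_eq_sum_ones, Nat.cast_sum, upperSupport, sum_filter, ← add_sum_erase _ _ (mem_univ 0)]
    simp only [ne_eq, not_true_eq_false, false_and, if_false, zero_add]
    refine sum_le_sum fun i hi => ?_
    have hi0 := ne_of_mem_erase hi
    split_ifs with h
    · simpa using h1 i hi0
    · exact not_lt.1 fun hlt => h ⟨hi0, hlt⟩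
  rw [← add_sum_erase _ _ (mem_univ 0)]
  linarith

theorem finite_boxReps {u : Fin (n + 1) → E} {Λ : AddSubgroup E}
    (hfin : ∀ m, (dilatePoints u Λ m).Finite) : (boxReps u Λ).Finite := by
  refine ((Set.finite_Iic (n + 1)).biUnion fun h _ => finite_lexReps (hfin h)).subset ?_
  rintro f ⟨h0, h1, h, hf⟩
  refine Set.mem_biUnion ?_ hf
  have hlt := sum_lt_card_add_one h0 h1
  rw [hf.2.1] at hlt
  have hS : #(upperSupport f) ≤ n + 1 := by simpa using card_le_univ (upperSupport f)
  have : h < #(upperSupport f) + 1 := by exact_mod_cast hlt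
  exact Set.mem_Iic.2 (by omega)

theorem boxPart_mem_boxReps {u : Fin (n + 1) → E} {Λ : AddSubgroup E} (hu : ∀ i, u i ∈ Λ)
    {m : ℕ} {t : Fin (n + 1) → ℝ} (ht : t ∈ lexReps u Λ m) : boxPart t ∈ boxReps u Λ := by
  obtain ⟨⟨hnn, hface⟩, hm, hΛ⟩ := ht
  have hsum : ∑ i, boxPart t i = m - (∑ i, integerPart t i : ℕ) := by
    simp [boxPart, hm]
  have hle : ∑ i, integerPart t i ≤ m := by
    have : 0 ≤ ∑ i, boxPart t i := sum_nonneg fun i _ => boxPart_nonneg hnn i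
    rw [hsum] at this
    exact_mod_cast sub_nonneg.1 this
  refine ⟨boxPart_zero_lt_one t, fun i hi => boxPart_le_one hi, m - ∑ i, integerPart t i,
    ⟨boxPart_nonneg hnn, by rwa [upperSupport_boxPart]⟩, ?_, ?_⟩
  · rw [hsum, Nat.cast_sub hle]
  · simp only [boxPart, sub_smul, sum_sub_distrib, Nat.cast_smul_eq_nsmul]
    exact Λ.sub_mem hΛ (Λ.sum_mem fun i _ => Λ.nsmul_mem (hu i) _)

theorem add_mem_lexReps {u : Fin (n + 1) → E} {Λ : AddSubgroup E} (hu : ∀ i, u i ∈ Λ)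
    {h : ℕ} {f : Fin (n + 1) → ℝ} (hf : f ∈ lexReps u Λ h) {c : Fin (n + 1) → ℕ}
    (hc : ∀ i, c i ≠ 0 → i ∈ insert 0 (upperSupport f)) :
    (fun i => f i + c i) ∈ lexReps u Λ (h + ∑ i, c i) := by
  obtain ⟨⟨hnn, hface⟩, hm, hΛ⟩ := hf
  refine ⟨⟨fun i => add_nonneg (hnn i) (Nat.cast_nonneg _), by rwa [upperSupport_add hc]⟩,
    by simp [sum_add_distrib, hm], ?_⟩
  simp only [add_smul, sum_add_distrib, Nat.cast_smul_eq_nsmul]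
  exact Λ.add_mem hΛ (Λ.sum_mem fun i _ => Λ.nsmul_mem (hu i) _)

theorem eval_preHilbertPoly_eq_zero {k h m : ℕ} (hm : m < h) (hh : h ≤ k) :
    (Polynomial.preHilbertPoly ℚ k h).eval (m : ℚ) = 0 := by
  have hz := ascPochhammer_eval_neg_coe_nat_of_lt (R := ℚ) (n := k) (k := h - m - 1) (by omega)
  have : (m : ℚ) - h + 1 = -((h - m - 1 : ℕ) : ℚ) := by
    rw [Nat.sub_sub, Nat.cast_sub (by omega)]
    push_cast
    ring
  simp [Polynomial.preHilbertPoly, this, hz]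

theorem ncard_boxPart_fiber {u : Fin (n + 1) → E} {Λ : AddSubgroup E} (hu : ∀ i, u i ∈ Λ)
    {h : ℕ} {f : Fin (n + 1) → ℝ} (h0 : f 0 < 1) (h1 : ∀ i ≠ 0, f i ≤ 1)
    (hf : f ∈ lexReps u Λ h) (m : ℕ) :
    ({t ∈ lexReps u Λ m | boxPart t = f}.ncard : ℚ) =
      (Polynomial.preHilbertPoly ℚ #(upperSupport f) h).eval (m : ℚ) := by
  rcases lt_or_ge m h with hmh | hmh
  · have hle : h ≤ #(upperSupport f) := by
      have := sum_lt_card_add_one h0 h1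
      rw [hf.2.1] at this
      exact Nat.lt_succ_iff.1 (by exact_mod_cast this)
    rw [eval_preHilbertPoly_eq_zero hmh hle]
    have : {t ∈ lexReps u Λ m | boxPart t = f} = ∅ := by
      rw [Set.eq_empty_iff_forall_notMem]
      rintro t ⟨ht, rfl⟩
      have h2 : ∑ i, boxPart t i = m - ∑ i, (integerPart t i : ℝ) := by simp [boxPart, ht.2.1]
      have h3 : (0 : ℝ) ≤ ∑ i, (integerPart t i : ℝ) := by positivity
      rw [hf.2.1] at h2
      have : (m : ℝ) < h := by exact_mod_cast hmh
      linarith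
    simp [this]
  · rw [Polynomial.preHilbertPoly_eq_choose_sub_add _ _ hmh]
    have himage : {t ∈ lexReps u Λ m | boxPart t = f} =
        (fun (c : Fin (n + 1) →₀ ℕ) i => f i + (c i : ℝ)) ''
          (finsuppAntidiag (insert 0 (upperSupport f)) (m - h) : Finset (Fin (n + 1) →₀ ℕ)) := by
      ext t
      simp only [Set.mem_image, mem_coe, mem_finsuppAntidiag']
      constructor
      · rintro ⟨ht, rfl⟩
        refine ⟨Finsupp.equivFunOnFinite.symm (integerPart t), ⟨?_, ?_⟩, ?_⟩
        · have h2 : ∑ i, boxPart t i = m - ∑ i, (integerPart t i : ℝ) := by simp [boxPart, ht.2.1]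
          rw [hf.2.1] at h2
          have h3 : m = h + ∑ i, integerPart t i := by
            have : (m : ℝ) = h + ∑ i, (integerPart t i : ℝ) := by linarith
            exact_mod_cast this
          rw [Finsupp.sum_fintype _ _ fun _ => rfl]
          simp
          omega
        · intro i hi
          rw [upperSupport_boxPart]
          exact integerPart_mem (by simpa using hi)
        · ext i
          simp [boxPart]
      · rintro ⟨c, ⟨hcs, hc⟩, rfl⟩
        have hc' : ∀ i, c i ≠ 0 → i ∈ insert 0 (upperSupport f) :=
          fun i hi => hc (Finsupp.mem_support_iff.2 hi)
        rw [Finsupp.sum_fintype _ _ fun _ => rfl] at hcs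
        refine ⟨?_, boxPart_add hf.1.1 h0 h1 hc'⟩
        have := add_mem_lexReps hu hf hc'
        rwa [hcs, Nat.add_sub_cancel' hmh] at this
    have hinj : Function.Injective (fun (c : Fin (n + 1) →₀ ℕ) i => f i + (c i : ℝ)) := by
      intro c c' hcc
      ext i
      simpa using congrFun hcc i
    rw [himage, Set.ncard_image_of_injective _ hinj, Set.ncard_coe_finset,
      card_finsuppAntidiag_nat_eq_choose, card_insert_of_notMem (by simp)]
    congr 1
    rw [show #(upperSupport f) + 1 + (m - h) - 1 = m - h + #(upperSupport f) by omega]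
    exact Nat.choose_symm_add

theorem exists_polynomial_of_finite [FiniteDimensional ℝ E] {u : Fin (n + 1) → E}
    {Λ : AddSubgroup E} (hu : ∀ i, u i ∈ Λ) (hfin : ∀ m, (dilatePoints u Λ m).Finite) :
    ∃ p : Polynomial ℚ, p.natDegree ≤ Module.finrank ℝ (vectorSpan ℝ (Set.range u)) ∧
      ∀ m : ℕ, ((dilatePoints u Λ m).ncard : ℚ) = p.eval (m : ℚ) := by
  classical
  choose! h hh using fun f (hf : f ∈ boxReps u Λ) => hf.2.2
  refine ⟨∑ f ∈ (finite_boxReps hfin).toFinset, Polynomial.preHilbertPoly ℚ #(upperSupport f) (h f),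
    Polynomial.natDegree_sum_le_of_forall_le _ _ fun f hf => ?_, fun m => ?_⟩
  · rw [Polynomial.natDegree_preHilbertPoly]
    exact (hh f ((Set.Finite.mem_toFinset _).1 hf)).1.2.card_le (by simp)
  · rw [← ncard_lexReps, Polynomial.eval_finsetSum,
      Set.ncard_eq_toFinset_card _ (finite_lexReps (hfin m)),
      card_eq_sum_card_fiberwise (f := boxPart) (t := (finite_boxReps hfin).toFinset)
        fun t ht => by simpa using boxPart_mem_boxReps hu (by simpa using ht), Nat.cast_sum]
    refine sum_congr rfl fun f hf => ?_
    have hf' := (Set.Finite.mem_toFinset _).1 hf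
    rw [← ncard_boxPart_fiber hu hf'.1 hf'.2.1 (hh f hf') m, ← Set.ncard_coe_finset]
    congr 2
    ext t
    simp

theorem choose_le_ncard_dilatePoints {u : Fin (n + 1) → E} {Λ : AddSubgroup E} (hu : ∀ i, u i ∈ Λ)
    {m : ℕ} (hfin : (dilatePoints u Λ m).Finite) :
    (m + Module.finrank ℝ (vectorSpan ℝ (Set.range u))).choose
      (Module.finrank ℝ (vectorSpan ℝ (Set.range u))) ≤ (dilatePoints u Λ m).ncard := by
  classical
  obtain ⟨T, hT, hspan, hind⟩ := exists_affineIndependent ℝ E (Set.range u)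
  obtain ⟨S, hinj, rfl⟩ : ∃ S : Finset (Fin (n + 1)), Set.InjOn u S ∧ u '' S = T := by
    obtain ⟨S, hS, hinj⟩ := (Set.surjOn_image u (u ⁻¹' T)).exists_bijOn_subset
    refine ⟨(Set.toFinite S).toFinset, by simpa using hinj.injOn, ?_⟩
    rw [Set.Finite.coe_toFinset, hinj.image_eq, Set.image_preimage_eq_of_subset hT]
  have hindS : AffineIndependent ℝ fun i : S => u i :=
    hind.comp_embedding ⟨fun i : S => (⟨u i, i, i.2, rfl⟩ : u '' S), fun i j hij =>
      Subtype.ext (hinj i.2 j.2 (congrArg Subtype.val hij))⟩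
  have hvs : vectorSpan ℝ (Set.range u) = vectorSpan ℝ (Set.range fun i : S => u i) := by
    rw [← direction_affineSpan, ← hspan, direction_affineSpan, Set.image_eq_range]
    rfl
  have hne : S.Nonempty := by
    have : (affineSpan ℝ (u '' S) : Set E).Nonempty := by
      rw [hspan]
      exact (Set.range_nonempty u).affineSpan ℝ
    simpa using (affineSpan_nonempty ℝ).1 this
  have : Nonempty S := hne.to_subtype
  have hcard : #S = Module.finrank ℝ (vectorSpan ℝ (Set.range u)) + 1 := by
    rw [hvs, hindS.finrank_vectorSpan_add_one, Fintype.card_coe]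
  set k := Module.finrank ℝ (vectorSpan ℝ (Set.range u))
  have hc : (m + k).choose k = #(finsuppAntidiag S m) := by
    rw [card_finsuppAntidiag_nat_eq_choose, hcard, show k + 1 + m - 1 = m + k by omega]
    exact Nat.choose_symm_add.symm
  have hsumS : ∀ c : Fin (n + 1) →₀ ℕ, c.support ⊆ S → ∀ g : Fin (n + 1) → ℕ → E,
      (∀ i, g i 0 = 0) → ∑ i, g i (c i) = ∑ i ∈ S, g i (c i) := fun c hcS g hg =>
    (sum_subset (subset_univ S) fun i _ hi => by
      rw [Finsupp.notMem_support_iff.1 fun h => hi (hcS h), hg]).symm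
  rw [hc, ← Set.ncard_coe_finset]
  refine Set.ncard_le_ncard_of_injOn (fun c => ∑ i, (c i : ℝ) • u i) (fun c hc => ?_) ?_ hfin
  · obtain ⟨hcs, -⟩ := mem_finsuppAntidiag'.1 (mem_coe.1 hc)
    rw [Finsupp.sum_fintype _ _ fun _ => rfl] at hcs
    refine ⟨?_, fun i => c i, fun i => Nat.cast_nonneg _, ?_, rfl⟩
    · simp only [Nat.cast_smul_eq_nsmul]
      exact Λ.sum_mem fun i _ => Λ.nsmul_mem (hu i) _
    · rw [← hcs, Nat.cast_sum]
  · intro c hc c' hc' hcc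
    obtain ⟨hs, hS⟩ := mem_finsuppAntidiag.1 (mem_coe.1 hc)
    obtain ⟨hs', hS'⟩ := mem_finsuppAntidiag.1 (mem_coe.1 hc')
    dsimp only at hcc
    rw [hsumS c hS (fun i a => (a : ℝ) • u i) (by simp),
      hsumS c' hS' (fun i a => (a : ℝ) • u i) (by simp), ← sum_coe_sort S, ← sum_coe_sort S] at hcc
    rw [← sum_coe_sort] at hs hs'
    have h0 := hindS.eq_zero_of_sum_eq_zero (s := univ) (w := fun i : S => (c i : ℝ) - c' i)
      (by rw [sum_sub_distrib, sub_eq_zero]; exact_mod_cast hs.trans hs'.symm)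
      (by simp only [sub_smul, sum_sub_distrib]; exact sub_eq_zero.2 hcc)
    ext i
    by_cases hi : i ∈ S
    · exact_mod_cast sub_eq_zero.1 (h0 ⟨i, hi⟩ (mem_univ _))
    · rw [Finsupp.notMem_support_iff.1 fun h => hi (hS h),
        Finsupp.notMem_support_iff.1 fun h => hi (hS' h)]

end

theorem le_natDegree_of_choose_le {p : Polynomial ℚ} {k : ℕ}
    (hp : ∀ m : ℕ, ((m + k).choose k : ℚ) ≤ p.eval (m : ℚ)) : k ≤ p.natDegree := by
  by_contra! hlt
  set q := Polynomial.preHilbertPoly ℚ k 0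
  have hq : ∀ m : ℕ, q.eval (m : ℚ) = (m + k).choose k := fun m => by
    simpa using Polynomial.preHilbertPoly_eq_choose_sub_add ℚ k (Nat.zero_le m)
  have hq0 : q ≠ 0 := fun h => by simpa [h] using hq 0
  have hdeg : p.degree < q.degree := by
    refine Polynomial.degree_lt_degree ?_
    rwa [Polynomial.natDegree_preHilbertPoly]
  have hlim := (Polynomial.div_tendsto_atTop_zero_of_degree_lt p q hdeg).comp
    (tendsto_natCast_atTop_atTop (R := ℚ))
  obtain ⟨m, hm⟩ := (hlim.eventually_lt_const one_pos).exists
  have hpos : (0 : ℚ) < (m + k).choose k := by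
    exact_mod_cast Nat.choose_pos (Nat.le_add_left k m)
  rw [Function.comp_apply, hq, div_lt_one hpos] at hm
  exact absurd (hp m) (not_le.2 hm)

/-- `latticePts d` as an additive subgroup. -/
def latticeSubgroup (d : ℕ) : AddSubgroup (Fin d → ℝ) where
  carrier := latticePts d
  zero_mem' := ⟨0, by ext; simp⟩
  add_mem' := by
    rintro _ _ ⟨v, rfl⟩ ⟨w, rfl⟩
    exact ⟨v + w, by ext; simp⟩
  neg_mem' := by
    rintro _ ⟨v, rfl⟩
    exact ⟨-v, by ext; simp⟩

theorem finite_inter_latticePts {d : ℕ} {K : Set (Fin d → ℝ)} (hK : Bornology.IsBounded K) :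
    (K ∩ latticePts d).Finite := by
  obtain ⟨R, hR⟩ := hK.exists_norm_le
  refine ((Set.finite_Icc (fun _ : Fin d => -⌈R⌉) fun _ => ⌈R⌉).image
    fun v i => (v i : ℝ)).subset ?_
  rintro _ ⟨hx, v, rfl⟩
  refine ⟨v, ⟨fun i => ?_, fun i => ?_⟩, rfl⟩ <;>
    have h := abs_le.1 ((norm_le_pi_norm _ i).trans (hR _ hx)) <;>
    have h' := Int.le_ceil R
  · have : -(⌈R⌉ : ℝ) ≤ v i := by linarith [h.1]
    exact_mod_cast this
  · have : (v i : ℝ) ≤ ⌈R⌉ := h.2.trans h'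
    exact_mod_cast this

theorem smul_image_convexHull_range {E : Type*} [AddCommGroup E] [Module ℝ E] {n : ℕ}
    (u : Fin (n + 1) → E) (m : ℕ) :
    (fun x => (m : ℝ) • x) '' convexHull ℝ (Set.range u) =
      {x | ∃ t : Fin (n + 1) → ℝ, 0 ≤ t ∧ ∑ i, t i = m ∧ ∑ i, t i • u i = x} := by
  have hhull : convexHull ℝ (Set.range u) =
      {x | ∃ t : Fin (n + 1) → ℝ, 0 ≤ t ∧ ∑ i, t i = 1 ∧ ∑ i, t i • u i = x} := by
    classical
    have := (Fintype.linearCombination ℝ u).image_convexHull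
      (Set.range fun i : Fin (n + 1) => (Pi.single i 1 : Fin (n + 1) → ℝ))
    rw [convexHull_rangle_single_eq_stdSimplex, ← Set.range_comp] at this
    have hu : (Fintype.linearCombination ℝ u) ∘ (fun i => Pi.single i 1) = u := by
      ext i
      simp [Fintype.linearCombination_apply_single]
    rw [hu] at this
    rw [← this]
    ext x
    simp [stdSimplex, Fintype.linearCombination_apply, Pi.le_def, and_assoc]
  rw [hhull]
  ext x
  constructor
  · rintro ⟨_, ⟨t, ht, h1, rfl⟩, rfl⟩
    refine ⟨(m : ℝ) • t, smul_nonneg (Nat.cast_nonneg m) ht, ?_, ?_⟩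
    · simp [← mul_sum, h1]
    · simp [mul_smul, smul_sum]
  · rintro ⟨t, ht, hm, rfl⟩
    rcases Nat.eq_zero_or_pos m with rfl | hpos
    · have ht0 : ∀ i, t i = 0 := fun i =>
        (sum_eq_zero_iff_of_nonneg fun j _ => ht j).1 (by simpa using hm) i (mem_univ i)
      refine ⟨u 0, ⟨Pi.single 0 1, by simp, by simp, ?_⟩, by simp [ht0]⟩
      simp [Pi.single_apply, ite_smul]
    · have hm0 : (m : ℝ) ≠ 0 := by positivity
      refine ⟨∑ i, ((m : ℝ)⁻¹ • t) i • u i,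
        ⟨(m : ℝ)⁻¹ • t, smul_nonneg (by positivity) ht, ?_, rfl⟩, ?_⟩
      · simp [← mul_sum, hm, hm0]
      · simp [smul_sum, smul_smul, hm0]

end LexTriangulation

/-- Ehrhart's theorem: for every lattice polytope `P ⊆ ℝ^d` there is a polynomial `f`
with rational coefficients, of degree `dim P`, such that for every nonnegative integer `m`
the number of lattice points in the dilation `m • P` equals `f(m)`. -/
theorem ehrhart_polynomial_exists (d : ℕ) (V : Finset (Fin d → ℤ)) (hV : V.Nonempty)
    (P : Set (Fin d → ℝ))
    (hP : P = convexHull ℝ ((fun v : Fin d → ℤ => fun i => (v i : ℝ)) '' (V : Set (Fin d → ℤ)))) :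
    ∃ f : Polynomial ℚ,
      f.natDegree = Module.finrank ℝ (affineSpan ℝ P).direction ∧
      ∀ m : ℕ,
        ((((fun x => (m : ℝ) • x) '' P ∩ latticePts d).ncard : ℚ)) = f.eval (m : ℚ) := by
  obtain ⟨n, hn⟩ : ∃ n, V.card = n + 1 := Nat.exists_eq_succ_of_ne_zero hV.card_pos.ne'
  let e := (V.equivFinOfCardEq hn).symm
  let u : Fin (n + 1) → Fin d → ℝ := fun j i => ((e j : Fin d → ℤ) i : ℝ)
  have hu : ∀ j, u j ∈ latticeSubgroup d := fun j => ⟨e j, rfl⟩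
  have hrange : (fun v : Fin d → ℤ => fun i => (v i : ℝ)) '' (V : Set (Fin d → ℤ)) =
      Set.range u := by
    ext x
    constructor
    · rintro ⟨v, hv, rfl⟩
      exact ⟨e.symm ⟨v, hv⟩, by simp [u]⟩
    · rintro ⟨j, rfl⟩
      exact ⟨e j, (e j).2, rfl⟩
  rw [hrange] at hP
  subst hP
  have hpts : ∀ m : ℕ, (fun x => (m : ℝ) • x) '' convexHull ℝ (Set.range u) ∩ latticePts d =
      dilatePoints u (latticeSubgroup d) m := fun m => by
    rw [smul_image_convexHull_range, Set.inter_comm]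
    rfl
  have hfin : ∀ m, (dilatePoints u (latticeSubgroup d) m).Finite := fun m => by
    rw [← hpts]
    refine finite_inter_latticePts ?_
    exact (isBounded_convexHull.2 (Set.finite_range u).isBounded).smul₀ (m : ℝ)
  obtain ⟨p, hdeg, hp⟩ := exists_polynomial_of_finite hu hfin
  refine ⟨p, ?_, fun m => by rw [hpts, hp]⟩
  rw [affineSpan_convexHull, direction_affineSpan]
  refine hdeg.antisymm (le_natDegree_of_choose_le fun m => ?_)
  rw [← hp]
  exact_mod_cast choose_le_ncard_dilatePoints hu (hfin m)
end

section
/- For every lattice polytope P in ℝ^d of dimension d, the leading coefficient of the Ehrhart polynomial of P (the polynomial f with f(m) = |mP ∩ ℤ^d| for all nonnegative integers m) equals the Euclidean volume of P. -/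
open Filter Topology in
/-- If `p(n) / n^d` tends to a nonzero limit along the naturals, then that limit is the leading
coefficient of `p`. -/
theorem Polynomial.leadingCoeff_eq_of_tendsto_div_pow (p : Polynomial ℝ) (d : ℕ) {c : ℝ}
    (hc : c ≠ 0)
    (h : Tendsto (fun n : ℕ => p.eval (n : ℝ) / (n : ℝ) ^ d) atTop (𝓝 c)) :
    p.leadingCoeff = c := by
  have hcast : Tendsto (fun n : ℕ => (n : ℝ)) atTop atTop := tendsto_natCast_atTop_atTop
  have hX : ∀ x : ℝ, (Polynomial.X ^ d : Polynomial ℝ).eval x = x ^ d := by simp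
  rcases lt_trichotomy p.degree (Polynomial.X ^ d : Polynomial ℝ).degree with hlt | heq | hgt
  · have h0 := (Polynomial.div_tendsto_atTop_zero_of_degree_lt p _ hlt).comp hcast
    simp only [hX, Function.comp_def] at h0
    exact absurd (tendsto_nhds_unique h h0) hc
  · have h0 := (Polynomial.div_tendsto_atTop_leadingCoeff_div_of_degree_eq p _ heq).comp hcast
    simp only [hX, Function.comp_def, Polynomial.leadingCoeff_X_pow, div_one] at h0
    exact tendsto_nhds_unique h0 h
  · have h0 := (Polynomial.abs_div_tendsto_atTop_atTop_of_degree_gt p _ hgt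
      (pow_ne_zero _ Polynomial.X_ne_zero)).comp hcast
    simp only [hX, Function.comp_def] at h0
    exact absurd h.abs (not_tendsto_nhds_of_tendsto_atTop h0 _)

theorem latticePts_eq_span (d : ℕ) :
    latticePts d = (Submodule.span ℤ (Set.range (Pi.basisFun ℝ (Fin d))) : Set (Fin d → ℝ)) := by
  ext x
  rw [SetLike.mem_coe, (Pi.basisFun ℝ (Fin d)).mem_span_iff_repr_mem ℤ]
  simp only [latticePts, Set.mem_range, Pi.basisFun_repr, algebraMap_int_eq, eq_intCast]
  constructor
  · rintro ⟨v, rfl⟩ i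
    exact ⟨v i, rfl⟩
  · intro h
    choose v hv using h
    exact ⟨v, funext hv⟩

open Pointwise in
theorem ncard_smul_inter_latticePts {d : ℕ} (s : Set (Fin d → ℝ)) {r : ℝ} (hr : r ≠ 0) :
    ((fun x => r • x) '' s ∩ latticePts d).ncard =
      Nat.card ↑(s ∩ r⁻¹ • (Submodule.span ℤ (Set.range (Pi.basisFun ℝ (Fin d))) :
        Set (Fin d → ℝ))) := by
  rw [Nat.card_coe_set_eq, ← Set.ncard_image_of_injective (s ∩ _) (smul_right_injective _ hr),
    Set.image_inter (smul_right_injective _ hr), latticePts_eq_span]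
  congr 2
  exact (smul_inv_smul₀ hr _).symm

/-- For a full-dimensional lattice polytope `P ⊆ ℝ^d`, the leading coefficient of its
Ehrhart polynomial (the polynomial `f` with `f(m) = |mP ∩ ℤ^d|` for all `m ∈ ℤ_{≥0}`)
equals the Euclidean volume of `P`. -/
theorem ehrhart_leadingCoeff_eq_volume (d : ℕ) (V : Finset (Fin d → ℤ)) (hV : V.Nonempty)
    (P : Set (Fin d → ℝ))
    (hP : P = convexHull ℝ ((fun v : Fin d → ℤ => fun i => (v i : ℝ)) '' (V : Set (Fin d → ℤ))))
    (hdim : Module.finrank ℝ (affineSpan ℝ P).direction = d)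
    (f : Polynomial ℚ)
    (hf : ∀ m : ℕ,
      ((((fun x => (m : ℝ) • x) '' P ∩ latticePts d).ncard : ℚ)) = f.eval (m : ℚ)) :
    (f.leadingCoeff : ℝ) = (MeasureTheory.volume P).toReal := by
  have hfin := (V.finite_toSet).image (fun v : Fin d → ℤ => fun i => (v i : ℝ))
  have hcpt : IsCompact P := hP ▸ hfin.isCompact_convexHull ℝ
  have hconv : Convex ℝ P := hP ▸ convex_convexHull ℝ _
  have hne : P.Nonempty := hP ▸ (hV.to_set.image _).convexHull
  have htop : affineSpan ℝ P = ⊤ := by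
    rw [← AffineSubspace.direction_eq_top_iff_of_nonempty ((affineSpan_nonempty ℝ).2 hne)]
    exact Submodule.eq_top_of_finrank_eq (by rw [hdim, Module.finrank_fin_fun])
  have hint : (interior P).Nonempty := hconv.interior_nonempty_iff_affineSpan_eq_top.2 htop
  have hpos : MeasureTheory.volume.real P ≠ 0 :=
    (ENNReal.toReal_pos (MeasureTheory.Measure.measure_pos_of_nonempty_interior _ hint).ne'
      hcpt.measure_lt_top.ne).ne'
  have hlim := tendsto_card_div_pow_atTop_volume P hcpt.isBounded hcpt.measurableSet
    (hconv.addHaar_frontier MeasureTheory.volume)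
  rw [Fintype.card_fin] at hlim
  have key := Polynomial.leadingCoeff_eq_of_tendsto_div_pow (f.map (algebraMap ℚ ℝ)) d hpos <|
    hlim.congr' <| by
      filter_upwards [Filter.eventually_gt_atTop 0] with n hn
      rw [← ncard_smul_inter_latticePts P (Nat.cast_ne_zero.2 hn.ne'),
        Polynomial.eval_map_algebraMap, ← map_natCast (algebraMap ℚ ℝ) n,
        Polynomial.aeval_algebraMap_apply, Polynomial.coe_aeval_eq_eval, ← hf n]
      simp
  rw [Polynomial.leadingCoeff_map] at key
  exact key
end

section
/- Every two-dimensional lattice polygon P ⊂ ℝ² has the integer decomposition property: every lattice point of the cone C_P = {λ(x,1) : λ ≥ 0, x ∈ P} ⊂ ℝ³ at height m can be written as a sum of m lattice points of C_P at height one. -/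
/-- The real point of `ℝ²` corresponding to an integer vector. -/
def Z2R (v : Fin 2 → ℤ) : Fin 2 → ℝ := fun i => (v i : ℝ)

/-- The cone over a polygon `P ⊆ ℝ²`, namely `C_P = {λ(x,1) : λ ≥ 0, x ∈ P} ⊆ ℝ³`,
modelled as a subset of `(Fin 2 → ℝ) × ℝ`; the height of a point is its last coordinate. -/
def coneOver (P : Set (Fin 2 → ℝ)) : Set ((Fin 2 → ℝ) × ℝ) :=
  {p | ∃ lam : ℝ, 0 ≤ lam ∧ ∃ x ∈ P, p = (lam • x, lam)}

/-- Twice the signed area of the lattice triangle with vertices `a`, `b`, `c`. -/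
def latticeArea (a b c : Fin 2 → ℤ) : ℤ :=
  (b 0 - a 0) * (c 1 - a 1) - (b 1 - a 1) * (c 0 - a 0)

lemma Convex.combo_three_mem {E : Type*} [AddCommGroup E] [Module ℝ E] {P : Set E}
    (hP : Convex ℝ P) {a b c : E} (ha : a ∈ P) (hb : b ∈ P) (hc : c ∈ P) {α β γ : ℝ}
    (hα : 0 ≤ α) (hβ : 0 ≤ β) (hγ : 0 ≤ γ) (h : α + β + γ = 1) :
    α • a + β • b + γ • c ∈ P := by
  have := hP.sum_mem (t := Finset.univ) (w := ![α, β, γ]) (z := ![a, b, c])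
    (by intro i _; fin_cases i <;> simpa) (by simpa [Fin.sum_univ_three] using h)
    (by intro i _; fin_cases i <;> simpa)
  simpa [Fin.sum_univ_three] using this

/-- If the coefficient of `a` in the barycentric expression of `x` is at least one, then the
vertex `a` splits off. -/
lemma split_vertex {P : Set (Fin 2 → ℝ)} (hP : Convex ℝ P) {a b c x : Fin 2 → ℤ} {α β γ : ℝ}
    (ha : Z2R a ∈ P) (hb : Z2R b ∈ P) (hc : Z2R c ∈ P)
    (hα : 1 ≤ α) (hβ : 0 ≤ β) (hγ : 0 ≤ γ) (hsum : α + β + γ = 2)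
    (hx : ∀ i, (x i : ℝ) = α * a i + β * b i + γ * c i) :
    ∃ w, Z2R w ∈ P ∧ Z2R (x - w) ∈ P := by
  refine ⟨a, ha, ?_⟩
  convert hP.combo_three_mem ha hb hc (sub_nonneg.2 hα) hβ hγ (by linarith) using 1
  ext i
  simp only [Z2R, Pi.sub_apply, Int.cast_sub, hx, Pi.add_apply, Pi.smul_apply, smul_eq_mul]
  ring

/-- A lattice point of the second dilate of a nondegenerate lattice triangle is a sum of two
lattice points of any convex set containing the triangle. -/
lemma split_two_of_triangle {P : Set (Fin 2 → ℝ)} (hP : Convex ℝ P) (x : Fin 2 → ℤ) (n : ℕ) :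
    ∀ (a b c : Fin 2 → ℤ) (α β γ : ℝ), (latticeArea a b c).natAbs = n → latticeArea a b c ≠ 0 →
      Z2R a ∈ P → Z2R b ∈ P → Z2R c ∈ P → 0 ≤ α → 0 ≤ β → 0 ≤ γ → α + β + γ = 2 →
      (∀ i, (x i : ℝ) = α * a i + β * b i + γ * c i) →
      ∃ w, Z2R w ∈ P ∧ Z2R (x - w) ∈ P := by
  induction n using Nat.strong_induction_on with
  | _ n ih =>
  have key : ∀ (a b c : Fin 2 → ℤ) (α β γ : ℝ), (latticeArea a b c).natAbs = n →
      latticeArea a b c ≠ 0 →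
      Z2R a ∈ P → Z2R b ∈ P → Z2R c ∈ P → 0 ≤ α → 0 ≤ β → 0 ≤ γ → α + β + γ = 2 →
      (∀ i, (x i : ℝ) = α * a i + β * b i + γ * c i) → α ≤ β → α ≤ γ →
      ∃ w, Z2R w ∈ P ∧ Z2R (x - w) ∈ P := by
    intro a b c α β γ hn hne ha hb hc hα hβ hγ hsum hx hαβ hαγ
    by_cases hβ1 : 1 ≤ β
    · exact split_vertex hP hb ha hc hβ1 hα hγ (by linarith) fun i => by rw [hx]; ring
    by_cases hγ1 : 1 ≤ γ
    · exact split_vertex hP hc ha hb hγ1 hα hβ (by linarith) fun i => by rw [hx]; ring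
    have hα1 : 0 < 1 - α := by linarith
    have hα0 : 0 < α := by linarith
    have hy : Z2R (a + b + c - x) ∈ P := by
      convert hP.combo_three_mem ha hb hc hα1.le (β := 1 - β) (γ := 1 - γ) (by linarith)
        (by linarith) (by linarith) using 1
      ext i
      simp only [Z2R, Pi.sub_apply, Int.cast_sub, hx, Pi.add_apply, Pi.smul_apply, smul_eq_mul,
        Int.cast_add]
      ring
    have harea : (latticeArea (a + b + c - x) b c : ℝ) = (1 - α) * latticeArea a b c := by
      have hγ' : γ = 2 - α - β := by linarith
      simp only [latticeArea, Pi.sub_apply, Pi.add_apply]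
      push_cast
      rw [hx, hx, hγ']
      ring
    have hne' : (latticeArea a b c : ℝ) ≠ 0 := by exact_mod_cast hne
    have hlt : (latticeArea (a + b + c - x) b c).natAbs < n := by
      rw [← hn]
      zify
      rw [← Int.cast_lt (R := ℝ)]
      push_cast
      rw [harea, abs_mul, abs_of_pos hα1]
      have := abs_pos.2 hne'
      nlinarith
    refine ih _ hlt (a + b + c - x) b c (α / (1 - α)) ((β - α) / (1 - α)) ((γ - α) / (1 - α)) rfl
      ?_ hy hb hc (by positivity) (div_nonneg (by linarith) hα1.le)
      (div_nonneg (by linarith) hα1.le) ?_ ?_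
    · have : (latticeArea (a + b + c - x) b c : ℝ) ≠ 0 := by
        rw [harea]
        exact mul_ne_zero hα1.ne' hne'
      exact_mod_cast this
    · field_simp
      linarith
    · intro i
      simp only [Pi.sub_apply, Pi.add_apply, Int.cast_sub, Int.cast_add, hx]
      field_simp
      have hγ' : γ = 2 - α - β := by linarith
      rw [hγ']
      ring
  intro a b c α β γ hn hne ha hb hc hα hβ hγ hsum hx
  have hrot : ∀ a b c, latticeArea b c a = latticeArea a b c := fun a b c => by
    simp only [latticeArea]; ring
  by_cases h1 : α ≤ β ∧ α ≤ γ
  · exact key a b c α β γ hn hne ha hb hc hα hβ hγ hsum hx h1.1 h1.2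
  by_cases h2 : β ≤ γ ∧ β ≤ α
  · exact key b c a β γ α (by rwa [hrot]) (by rwa [hrot]) hb hc ha hβ hγ hα (by linarith)
      (fun i => by rw [hx]; ring) h2.1 h2.2
  · have h3 : γ ≤ α ∧ γ ≤ β := by grind
    exact key c a b γ α β (by rwa [← hrot]) (by rwa [← hrot]) hc ha hb hγ hα hβ (by linarith)
      (fun i => by rw [hx]; ring) h3.1 h3.2

lemma latticeArea_ne_zero {a b c : Fin 2 → ℤ}
    (h : AffineIndependent ℝ ![Z2R a, Z2R b, Z2R c]) : latticeArea a b c ≠ 0 := by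
  intro h0
  have rel : ∀ q r : ℝ, (∀ i, q * (b i - a i) + r * (c i - a i) = 0) → q = 0 ∧ r = 0 := by
    intro q r hqr
    have := affineIndependent_iff.1 h Finset.univ ![-q - r, q, r]
      (by simp only [Fin.sum_univ_three, Matrix.cons_val]; ring) (by
        ext i
        simp only [Fin.sum_univ_three, Z2R, Matrix.cons_val, Pi.add_apply, Pi.smul_apply,
          smul_eq_mul, Pi.zero_apply]
        linarith [hqr i])
    exact ⟨by simpa using this 1 (Finset.mem_univ _), by simpa using this 2 (Finset.mem_univ _)⟩
  have h0' : ((b 0 : ℝ) - a 0) * (c 1 - a 1) - (b 1 - a 1) * (c 0 - a 0) = 0 := by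
    exact_mod_cast h0
  have e0 := rel (c 0 - a 0) (-(b 0 - a 0)) fun i => by fin_cases i <;> simp <;> linarith
  have e1 := rel (c 1 - a 1) (-(b 1 - a 1)) fun i => by fin_cases i <;> simp <;> linarith
  have := rel 1 1 fun i => by fin_cases i <;> simp <;> linarith [e0.1, e0.2, e1.1, e1.2]
  exact one_ne_zero this.1

lemma mem_coneOver_one {P : Set (Fin 2 → ℝ)} {v : Fin 2 → ℝ} (hv : v ∈ P) :
    (v, (1 : ℝ)) ∈ coneOver P :=
  ⟨1, zero_le_one, v, hv, by simp⟩

lemma mem_of_mem_coneOver_one {P : Set (Fin 2 → ℝ)} {v : Fin 2 → ℝ}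
    (hv : (v, (1 : ℝ)) ∈ coneOver P) : v ∈ P := by
  obtain ⟨lam, -, y, hy, h⟩ := hv
  simp only [Prod.mk.injEq] at h
  obtain ⟨rfl, rfl⟩ := h
  simpa using hy

/-- A lattice point of the cone over a lattice polygon at height `m + 1` is the sum of a lattice
point of the polygon and a lattice point of the cone at height `m`. -/
lemma exists_sub_mem_coneOver (V : Set (Fin 2 → ℤ)) (m : ℕ) (x : Fin 2 → ℤ)
    (hx : (Z2R x, ((m + 1 : ℕ) : ℝ)) ∈ coneOver (convexHull ℝ (Z2R '' V))) :
    ∃ w, Z2R w ∈ convexHull ℝ (Z2R '' V) ∧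
      (Z2R (x - w), (m : ℝ)) ∈ coneOver (convexHull ℝ (Z2R '' V)) := by
  have hconv := convex_convexHull ℝ (Z2R '' V)
  rcases Nat.eq_zero_or_pos m with rfl | hm
  · have hxP := mem_of_mem_coneOver_one (by simpa using hx)
    refine ⟨x, hxP, 0, le_rfl, _, hxP, ?_⟩
    ext <;> simp [Z2R]
  have hm' : (0 : ℝ) < m := by exact_mod_cast hm
  obtain ⟨lam, -, y, hy, hxy⟩ := hx
  simp only [Prod.mk.injEq] at hxy
  obtain ⟨hxy, rfl⟩ := hxy
  obtain ⟨ι, _, z, w, hz, hind, hw, hw1, rfl⟩ := eq_pos_convex_span_of_mem_convexHull hy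
  choose u hu huz using fun i => hz (Set.mem_range_self i)
  obtain rfl : (fun i => Z2R (u i)) = z := funext huz
  have huP : ∀ i, Z2R (u i) ∈ convexHull ℝ (Z2R '' V) := fun i =>
    subset_convexHull ℝ _ (hz (Set.mem_range_self i))
  classical
  by_cases hbig : ∃ i, 1 ≤ ((m + 1 : ℕ) : ℝ) * w i
  · obtain ⟨i, hi⟩ := hbig
    push_cast at hi
    refine ⟨u i, huP i, m, hm'.le,
      ∑ j, (((m + 1) * w j - if j = i then 1 else 0) / m) • Z2R (u j), ?_, ?_⟩
    · refine hconv.sum_mem (fun j _ => div_nonneg ?_ hm'.le) ?_ fun j _ => huP j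
      · split_ifs with hj
        · subst hj; linarith
        · have := hw j
          simp only [sub_zero]; positivity
      · rw [← Finset.sum_div, Finset.sum_sub_distrib, ← Finset.mul_sum, hw1]
        simp [hm'.ne']
    · have : Z2R (x - u i) = Z2R x - Z2R (u i) := by ext; simp [Z2R]
      rw [this, hxy, Finset.smul_sum, Finset.smul_sum]
      simp only [smul_smul, mul_div_cancel₀ _ hm'.ne', sub_smul, Finset.sum_sub_distrib]
      simp
  · push Not at hbig
    have hcard : Fintype.card ι ≤ 3 := by
      have h1 := hind.card_le_finrank_succ
      have h2 := Submodule.finrank_le (vectorSpan ℝ (Set.range fun i => Z2R (u i)))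
      simp only [Module.finrank_fin_fun] at h2
      omega
    have hne : (Finset.univ : Finset ι).Nonempty := by
      by_contra h
      rw [Finset.not_nonempty_iff_eq_empty] at h
      simp [h] at hw1
    have hlt := Finset.sum_lt_sum_of_nonempty hne fun i _ => hbig i
    rw [← Finset.mul_sum, hw1, mul_one] at hlt
    simp only [Finset.sum_const, Finset.card_univ, nsmul_eq_mul, mul_one, Nat.cast_lt] at hlt
    obtain rfl : m = 1 := by omega
    have e := (Fintype.equivFinOfCardEq (show Fintype.card ι = 3 by omega)).symm
    have hind' : AffineIndependent ℝ ![Z2R (u (e 0)), Z2R (u (e 1)), Z2R (u (e 2))] := by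
      have he : ![Z2R (u (e 0)), Z2R (u (e 1)), Z2R (u (e 2))] = fun i => Z2R (u (e i)) := by
        ext i
        fin_cases i <;> rfl
      rw [he]
      exact hind.comp_embedding e.toEmbedding
    rw [← e.sum_comp, Fin.sum_univ_three] at hw1 hxy
    obtain ⟨v, hv, hxv⟩ := split_two_of_triangle hconv x _ _ _ _
      (2 * w (e 0)) (2 * w (e 1)) (2 * w (e 2)) rfl (latticeArea_ne_zero hind')
      (huP _) (huP _) (huP _) (by linarith [hw (e 0)]) (by linarith [hw (e 1)])
      (by linarith [hw (e 2)]) (by linarith) fun i => by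
        have := congrFun hxy i
        simp only [Z2R, Pi.add_apply, Pi.smul_apply, smul_eq_mul] at this
        rw [this]
        push_cast
        ring
    exact ⟨v, hv, by simpa using mem_coneOver_one hxv⟩

/-- Every two-dimensional lattice polygon `P ⊆ ℝ²` has the integer decomposition property:
every lattice point of `C_P` at height `m` is a sum of `m` (not necessarily distinct)
lattice points of `C_P` at height one. -/
theorem polygon_has_idp (V : Finset (Fin 2 → ℤ)) (P : Set (Fin 2 → ℝ))
    (hP : P = convexHull ℝ (Z2R '' (V : Set (Fin 2 → ℤ))))
    (hdim : Module.finrank ℝ (affineSpan ℝ P).direction = 2) :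
    ∀ (m : ℕ) (x : Fin 2 → ℤ), (Z2R x, (m : ℝ)) ∈ coneOver P →
      ∃ w : Fin m → (Fin 2 → ℤ),
        (∀ i, (Z2R (w i), (1 : ℝ)) ∈ coneOver P) ∧ x = ∑ i, w i := by
  subst hP
  intro m
  induction m with
  | zero =>
    rintro x ⟨lam, -, y, -, h⟩
    simp only [Prod.mk.injEq, Nat.cast_zero] at h
    obtain ⟨h, rfl⟩ := h
    refine ⟨Fin.elim0, fun i => i.elim0, ?_⟩
    ext i
    simpa [Z2R] using congrFun h i
  | succ m ih =>
    intro x hx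
    obtain ⟨v, hv, hxv⟩ := exists_sub_mem_coneOver _ m x hx
    obtain ⟨w, hw, hsum⟩ := ih _ hxv
    refine ⟨Fin.cons v w, Fin.cases (mem_coneOver_one hv) hw, ?_⟩
    rw [Fin.sum_cons, ← hsum, add_sub_cancel]
end

section
/- For every integer r > 1, the Reeve tetrahedron R_r = conv((0,0,0), (1,0,0), (0,1,0), (1,1,r)) does not admit a unimodular covering: there is no finite family of 3-dimensional unimodular simplices whose union equals R_r. -/
/-- The real point of `ℝ³` corresponding to an integer vector. -/
def Z3R (v : Fin 3 → ℤ) : Fin 3 → ℝ := fun i => (v i : ℝ)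

/-- The Reeve tetrahedron `R_r = conv((0,0,0), (1,0,0), (0,1,0), (1,1,r)) ⊆ ℝ³`. -/
def reeve (r : ℤ) : Set (Fin 3 → ℝ) :=
  convexHull ℝ ({Z3R ![0, 0, 0], Z3R ![1, 0, 0], Z3R ![0, 1, 0], Z3R ![1, 1, r]} :
    Set (Fin 3 → ℝ))

/-- `S ⊆ ℝ³` is a `3`-dimensional unimodular simplex: the convex hull of lattice points
`v₀, v₁, v₂, v₃` whose difference vectors `v₁ - v₀, v₂ - v₀, v₃ - v₀` form a basis of
the lattice `ℤ³`. -/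
def IsUnimodularSimplex (S : Set (Fin 3 → ℝ)) : Prop :=
  ∃ v : Fin 4 → (Fin 3 → ℤ),
    (∀ x : Fin 3 → ℤ, ∃! c : Fin 3 → ℤ, x = ∑ i : Fin 3, c i • (v i.succ - v 0)) ∧
    S = convexHull ℝ (Set.range (fun i => Z3R (v i)))

/-- The facet inequalities of the Reeve tetrahedron hold at each of its points. -/
theorem reeve_facet_inequalities {r : ℤ} (hr : 0 ≤ r) {p : Fin 3 → ℝ} (hp : p ∈ reeve r) :
    0 ≤ p 2 ∧ p 2 ≤ r * p 0 ∧ p 2 ≤ r * p 1 ∧ r * p 0 + r * p 1 - p 2 ≤ r := by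
  have hr' : (0 : ℝ) ≤ r := by exact_mod_cast hr
  have hsub : reeve r ⊆ {p : Fin 3 → ℝ |
      0 ≤ p 2 ∧ p 2 ≤ r * p 0 ∧ p 2 ≤ r * p 1 ∧ r * p 0 + r * p 1 - p 2 ≤ r} := by
    refine convexHull_min ?_ ?_
    · rintro q (rfl | rfl | rfl | rfl) <;> simp [Z3R, hr']
    · rintro q ⟨hq₁, hq₂, hq₃, hq₄⟩ q' ⟨hq₁', hq₂', hq₃', hq₄'⟩ a b ha hb hab
      obtain rfl : b = 1 - a := by linarith
      simp only [Set.mem_ofPred_eq, Pi.add_apply, Pi.smul_apply, smul_eq_mul]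
      have combine {s t : ℝ} (hs : 0 ≤ s) (ht : 0 ≤ t) : 0 ≤ a * s + (1 - a) * t := by positivity
      refine ⟨combine hq₁ hq₁', ?_, ?_, ?_⟩
      · linarith [combine (sub_nonneg.2 hq₂) (sub_nonneg.2 hq₂')]
      · linarith [combine (sub_nonneg.2 hq₃) (sub_nonneg.2 hq₃')]
      · linarith [combine (sub_nonneg.2 hq₄) (sub_nonneg.2 hq₄')]
  exact hsub hp

/-- The lattice points of the Reeve tetrahedron `R_r` have last coordinate divisible by `r`. -/
theorem dvd_of_Z3R_mem_reeve {r : ℤ} (hr : 0 < r) {v : Fin 3 → ℤ} (hv : Z3R v ∈ reeve r) :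
    r ∣ v 2 := by
  obtain ⟨h₁, h₂, h₃, h₄⟩ := reeve_facet_inequalities hr.le hv
  simp only [Z3R] at h₁ h₂ h₃ h₄
  norm_cast at h₁ h₂ h₃ h₄
  have hx₀ : 0 ≤ v 0 := nonneg_of_mul_nonneg_right (h₁.trans h₂) hr
  have hy₀ : 0 ≤ v 1 := nonneg_of_mul_nonneg_right (h₁.trans h₃) hr
  have hx₁ : v 0 ≤ 1 := le_of_mul_le_mul_left (by linarith) hr
  have hy₁ : v 1 ≤ 1 := le_of_mul_le_mul_left (by linarith) hr
  obtain hx | hx : v 0 = 0 ∨ v 0 = 1 := by omega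
  · rw [hx, mul_zero] at h₂
    exact ⟨0, by omega⟩
  obtain hy | hy : v 1 = 0 ∨ v 1 = 1 := by omega
  · rw [hy, mul_zero] at h₃
    exact ⟨0, by omega⟩
  · rw [hx, hy] at h₄
    rw [hx] at h₂
    exact ⟨1, by omega⟩

/-- A unimodular simplex has a vertex whose last coordinate is not divisible by `r`, unless `r` is
a unit. -/
theorem IsUnimodularSimplex.exists_not_dvd {S : Set (Fin 3 → ℝ)} (hS : IsUnimodularSimplex S)
    {r : ℤ} (hr : ¬IsUnit r) : ∃ v : Fin 3 → ℤ, Z3R v ∈ S ∧ ¬r ∣ v 2 := by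
  obtain ⟨v, hbasis, rfl⟩ := hS
  by_contra! h
  have hdvd (i : Fin 4) : r ∣ v i 2 := h (v i) (subset_convexHull ℝ _ ⟨i, rfl⟩)
  obtain ⟨c, hc, -⟩ := hbasis (Pi.single 2 1)
  have hc₂ := congrFun hc 2
  simp only [Pi.single_eq_same, Finset.sum_apply, Pi.smul_apply, Pi.sub_apply, smul_eq_mul] at hc₂
  refine hr (isUnit_of_dvd_one ?_)
  rw [hc₂]
  exact Finset.dvd_sum fun i _ => ((hdvd _).sub (hdvd 0)).mul_left (c i)

/-- For every integer `r > 1`, the Reeve tetrahedron `R_r` admits no unimodular covering: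
there is no finite family of `3`-dimensional unimodular simplices whose union is `R_r`. -/
theorem reeve_no_unimodular_covering (r : ℤ) (hr : 1 < r) :
    ¬ ∃ (n : ℕ) (S : Fin n → Set (Fin 3 → ℝ)),
        (∀ i, IsUnimodularSimplex (S i)) ∧ reeve r = ⋃ i, S i := by
  rintro ⟨n, S, hS, hcover⟩
  have horigin : Z3R ![0, 0, 0] ∈ reeve r := subset_convexHull ℝ _ (by simp)
  rw [hcover] at horigin
  obtain ⟨i, -⟩ := Set.mem_iUnion.1 horigin
  have hunit : ¬IsUnit r := by rw [Int.isUnit_iff]; omega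
  obtain ⟨v, hv, hndvd⟩ := (hS i).exists_not_dvd hunit
  exact hndvd (dvd_of_Z3R_mem_reeve (by omega) (hcover ▸ Set.mem_iUnion_of_mem i hv))
end
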